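/- arXiv:1904.02224 — 2 statements merged into one kernel-verified Lean document; each statement's English description precedes it below -/
import Mathlib

section
/- Main theorem: let (V,b,μ) be a locally finite, weighted, connected graph with μ(x) ≥ μ_0 > 0, let q : [0,∞) → (0,∞) be non-decreasing with q(s) = O(s^α) for some 0 ≤ α ≤ 1, and let W : V → ℝ satisfy W(x) ≥ −q(r(x)). If 0 < α ≤ 1 assume {n^{α−1} d_n p_n} is bounded; if α = 0 assume d_n p_n / n ≤ K for all n ≥ N and some 0 < K < μ_0/2. Then H = Δ_θ² + W is essentially self-adjoint on the finitely supported functions C_c(V) in ℓ²(V,μ). -/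
open scoped BigOperators

/-- The formal magnetic Laplacian on a weighted graph. -/
noncomputable def magLap {V : Type*} (μ : V → ℝ) (b : V → V → ℝ) (θ : V → V → ℝ)
    (u : V → ℂ) (x : V) : ℂ :=
  (μ x : ℂ)⁻¹ * ∑' y, (b x y : ℂ) * (u x - Complex.exp (Complex.I * (θ x y : ℝ)) * u y)

/-- The term `P_ψ[u]`. -/
noncomputable def magP {V : Type*} (μ : V → ℝ) (b : V → V → ℝ) (θ : V → V → ℝ)
    (ψ u : V → ℂ) (x : V) : ℂ :=
  (μ x : ℂ)⁻¹ *
    ∑' y, (b x y : ℂ) * (ψ x - ψ y) * (u x - Complex.exp (Complex.I * (θ x y : ℝ)) * u y)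

/-- The cut-off function `χ_n`. -/
noncomputable def cutoff {V : Type*} (dist : V → ℕ) (n : ℕ) (x : V) : ℝ :=
  min (max ((2 * (n : ℝ) - (dist x : ℝ)) / (n : ℝ)) 0) 1

/-- Squared norm in `ℓ²(V, μ)`. -/
noncomputable def wnormSq {V : Type*} (μ : V → ℝ) (f : V → ℂ) : ℝ :=
  ∑' x, μ x * ‖f x‖ ^ 2

/-- Inner product in `ℓ²(V, μ)`. -/
noncomputable def wInner {V : Type*} (μ : V → ℝ) (f g : V → ℂ) : ℂ :=
  ∑' x, (μ x : ℂ) * f x * (starRingEnd ℂ) (g x)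

open Finset in
/-- Schur test on a finite set. -/
lemma sum_sum_mul_le_of_schur {V : Type*} (F : Finset V) (w : V → V → ℝ) (μ f g : V → ℝ) (C : ℝ)
    (hw : ∀ x y, 0 ≤ w x y) (hμ : ∀ x, 0 ≤ μ x) (hC : 0 ≤ C)
    (hrow : ∀ x ∈ F, ∑ y ∈ F, w x y ≤ C * μ x) (hcol : ∀ y ∈ F, ∑ x ∈ F, w x y ≤ C * μ y) :
    ∑ x ∈ F, ∑ y ∈ F, w x y * (f x * g y) ≤
      C * √(∑ x ∈ F, μ x * f x ^ 2) * √(∑ x ∈ F, μ x * g x ^ 2) := by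
  have h1 : ∑ p ∈ F ×ˢ F, w p.1 p.2 * f p.1 ^ 2 ≤ C * ∑ x ∈ F, μ x * f x ^ 2 := by
    rw [sum_product, mul_sum]
    refine sum_le_sum fun x hx => ?_
    dsimp only
    rw [← sum_mul]
    calc _ ≤ (C * μ x) * f x ^ 2 := by gcongr; exact hrow x hx
      _ = _ := by ring
  have h2 : ∑ p ∈ F ×ˢ F, w p.1 p.2 * g p.2 ^ 2 ≤ C * ∑ x ∈ F, μ x * g x ^ 2 := by
    rw [sum_product_right, mul_sum]
    refine sum_le_sum fun x hx => ?_
    dsimp only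
    rw [← sum_mul]
    calc _ ≤ (C * μ x) * g x ^ 2 := by gcongr; exact hcol x hx
      _ = _ := by ring
  have hf : 0 ≤ ∑ x ∈ F, μ x * f x ^ 2 :=
    sum_nonneg fun x _ => mul_nonneg (hμ x) (sq_nonneg _)
  rw [← sum_product' F F fun x y => w x y * (f x * g y)]
  have h3 := sum_sq_le_sum_mul_sum_of_sq_le_mul (F ×ˢ F)
    (r := fun p => w p.1 p.2 * (f p.1 * g p.2))
    (f := fun p => w p.1 p.2 * f p.1 ^ 2) (g := fun p => w p.1 p.2 * g p.2 ^ 2)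
    (fun p _ => mul_nonneg (hw _ _) (sq_nonneg _)) (fun p _ => mul_nonneg (hw _ _) (sq_nonneg _))
    (fun p _ => le_of_eq (by ring))
  have hg0 : 0 ≤ ∑ p ∈ F ×ˢ F, w p.1 p.2 * g p.2 ^ 2 :=
    sum_nonneg fun p _ => mul_nonneg (hw _ _) (sq_nonneg _)
  refine (Real.le_sqrt_of_sq_le (h3.trans (mul_le_mul h1 h2 hg0 (by positivity)))).trans ?_
  rw [Real.sqrt_mul (by positivity), Real.sqrt_mul hC, Real.sqrt_mul hC]
  refine le_of_eq ?_
  nth_rewrite 3 [← Real.mul_self_sqrt hC]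
  ring

open Finset in
lemma sum_weight_mul_le_sqrt_mul_sqrt {V : Type*} (F : Finset V) (μ f g : V → ℝ)
    (hμ : ∀ x, 0 ≤ μ x) :
    ∑ x ∈ F, μ x * (f x * g x) ≤ √(∑ x ∈ F, μ x * f x ^ 2) * √(∑ x ∈ F, μ x * g x ^ 2) := by
  have h3 := sum_sq_le_sum_mul_sum_of_sq_le_mul F (r := fun x => μ x * (f x * g x))
    (f := fun x => μ x * f x ^ 2) (g := fun x => μ x * g x ^ 2)
    (fun x _ => mul_nonneg (hμ x) (sq_nonneg _)) (fun x _ => mul_nonneg (hμ x) (sq_nonneg _))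
    (fun x _ => le_of_eq (by ring))
  rw [← Real.sqrt_mul (sum_nonneg fun x _ => mul_nonneg (hμ x) (sq_nonneg _))]
  exact Real.le_sqrt_of_sq_le h3

open Finset in
/-- Green's formula for a magnetic Laplacian on a finite set. -/
lemma sum_star_mul_magnetic_comm {V : Type*} (F : Finset V) (w : V → V → ℝ) (e : V → V → ℂ)
    (hw : ∀ x y, w x y = w y x) (he : ∀ x y, e y x = star (e x y)) (f v : V → ℂ) :
    ∑ x ∈ F, star (f x) * ∑ y ∈ F, (w x y : ℂ) * (v x - e x y * v y) =
      ∑ x ∈ F, ∑ y ∈ F, (w x y : ℂ) * (v x * star (f x - e x y * f y)) := by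
  have h : ∑ x ∈ F, ∑ y ∈ F, (w x y : ℂ) * (e x y * v y) * star (f x) =
      ∑ x ∈ F, ∑ y ∈ F, (w x y : ℂ) * (v x * star (e x y * f y)) := by
    rw [sum_comm]
    refine sum_congr rfl fun x _ => sum_congr rfl fun y _ => ?_
    rw [hw y x, star_mul', ← he x y]
    ring
  have h1 : ∀ x y, (w x y : ℂ) * (v x * star (f x - e x y * f y)) =
      (w x y : ℂ) * v x * star (f x) - (w x y : ℂ) * (v x * star (e x y * f y)) := by
    intro x y
    rw [star_sub]
    ring
  simp only [h1, sum_sub_distrib, ← h]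
  rw [← sum_sub_distrib]
  refine sum_congr rfl fun x _ => ?_
  rw [mul_sum, ← sum_sub_distrib]
  refine sum_congr rfl fun y _ => ?_
  ring

lemma le_of_commutator_estimate {E X a s S Q : ℝ} (hE : 0 ≤ E) (ha : 0 ≤ a) (hs : 0 ≤ s)
    (hS : 0 ≤ S) (hQ : 0 ≤ Q) (hX : X ≤ E + Q * S ^ 2)
    (h : E ≤ 2 * a * √X * s + 2 * a ^ 2 * S * s) :
    E ≤ 4 * a ^ 2 * s ^ 2 + 4 * (a * √Q) * S * s + 4 * a ^ 2 * S * s := by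
  have h1 : √X ≤ √E + √Q * S := by
    refine Real.sqrt_le_iff.2 ⟨by positivity, hX.trans ?_⟩
    have := Real.sq_sqrt hE
    have := Real.sq_sqrt hQ
    have : 0 ≤ √E * (√Q * S) := by positivity
    nlinarith
  have h2 : 2 * a * √X * s ≤ 2 * a * (√E + √Q * S) * s := by gcongr
  have h3 := sq_nonneg (√E - 2 * a * s)
  nlinarith [Real.sq_sqrt hE]

open Finset in
lemma abs_mul_sum_cutoff_le {V : Type*} (F : Finset V) (w : V → V → ℝ) (e : V → V → ℂ)
    (μ W χ : V → ℝ) (u v : V → ℂ) (I J : V → Prop) [DecidablePred I] [DecidablePred J]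
    (C ε Q ν : ℝ)
    (hw : ∀ x y, w x y = w y x) (hw0 : ∀ x y, 0 ≤ w x y)
    (he : ∀ x y, e y x = star (e x y)) (he1 : ∀ x y, ‖e x y‖ = 1)
    (hμ : ∀ x, 0 ≤ μ x) (hC : 0 ≤ C) (hε : 0 ≤ ε) (hQ : 0 ≤ Q)
    (hrow : ∀ x ∈ F, ∑ y ∈ F, w x y ≤ C * μ x)
    (hχ0 : ∀ x, 0 ≤ χ x) (hχ1 : ∀ x, χ x ≤ 1)
    (hχI : ∀ x ∈ F, χ x ≠ 0 → I x)
    (hχε : ∀ x y, w x y ≠ 0 → |χ x - χ y| ≤ ε)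
    (hχIJ : ∀ x y, w x y ≠ 0 → χ x ≠ χ y → I x ∧ J y)
    (hv : ∀ x ∈ F, I x → (μ x : ℂ) * v x = ∑ y ∈ F, (w x y : ℂ) * (u x - e x y * u y))
    (hu : ∀ x ∈ F, χ x ≠ 0 → ∑ y ∈ F, (w x y : ℂ) * (v x - e x y * v y) =
      (μ x : ℂ) * ((ν : ℂ) * Complex.I - (W x : ℂ)) * u x)
    (hW : ∀ x ∈ F, χ x ≠ 0 → -Q ≤ W x) :
    |ν| * ∑ x ∈ F, μ x * (χ x ^ 2 * ‖u x‖ ^ 2) ≤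
      4 * (C * ε) ^ 2 * √(∑ x ∈ F, μ x * (if J x then ‖u x‖ else 0) ^ 2) ^ 2
      + 4 * (C * ε * √Q) * √(∑ x ∈ F, μ x * ‖u x‖ ^ 2) *
        √(∑ x ∈ F, μ x * (if J x then ‖u x‖ else 0) ^ 2)
      + 4 * (C * ε) ^ 2 * √(∑ x ∈ F, μ x * ‖u x‖ ^ 2) *
        √(∑ x ∈ F, μ x * (if J x then ‖u x‖ else 0) ^ 2) := by
  have hcol : ∀ y ∈ F, ∑ x ∈ F, w x y ≤ C * μ y := by
    intro y hy
    simpa only [hw _ y] using hrow y hy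
  set S := √(∑ x ∈ F, μ x * ‖u x‖ ^ 2) with hSdef
  set s := √(∑ x ∈ F, μ x * (if J x then ‖u x‖ else 0) ^ 2) with hsdef
  set E := ∑ x ∈ F, ∑ y ∈ F, w x y * (|χ x ^ 2 - χ y ^ 2| * (‖v x‖ * ‖u y‖)) with hE
  set X := ∑ x ∈ F, μ x * (χ x * ‖v x‖) ^ 2 with hXdef
  set Z := ∑ x ∈ F, ∑ y ∈ F, (w x y : ℂ) *
    (((χ x ^ 2 - χ y ^ 2 : ℝ) : ℂ) * (v x * star (e x y * u y))) with hZ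
  have hS2 : S ^ 2 = ∑ x ∈ F, μ x * ‖u x‖ ^ 2 :=
    Real.sq_sqrt (sum_nonneg fun x _ => mul_nonneg (hμ x) (sq_nonneg _))
  have hE0 : 0 ≤ E := sum_nonneg fun x _ => sum_nonneg fun y _ =>
    mul_nonneg (hw0 _ _) (by positivity)
  have hZE : ‖Z‖ ≤ E := by
    refine (norm_sum_le _ _).trans (sum_le_sum fun x _ => (norm_sum_le _ _).trans
      (sum_le_sum fun y _ => le_of_eq ?_))
    rw [norm_mul, norm_mul, norm_mul, norm_star, norm_mul, he1, one_mul, Complex.norm_real,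
      Complex.norm_real, Real.norm_eq_abs, Real.norm_eq_abs, abs_of_nonneg (hw0 x y)]
  have hcs : ∀ z : ℂ, z * star z = ((‖z‖ ^ 2 : ℝ) : ℂ) := by
    intro z
    rw [Complex.star_def, Complex.mul_conj, Complex.normSq_eq_norm_sq]
  have hid : (X : ℂ) + Z = ((- ∑ x ∈ F, μ x * (W x * (χ x ^ 2 * ‖u x‖ ^ 2)) : ℝ) : ℂ)
      + ((ν * ∑ x ∈ F, μ x * (χ x ^ 2 * ‖u x‖ ^ 2) : ℝ) : ℂ) * Complex.I := by
    have hg := sum_star_mul_magnetic_comm F w e hw he (fun x => ((χ x ^ 2 : ℝ) : ℂ) * u x) v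
    have hl : ∑ x ∈ F, star (((χ x ^ 2 : ℝ) : ℂ) * u x) *
        ∑ y ∈ F, (w x y : ℂ) * (v x - e x y * v y) =
        ((- ∑ x ∈ F, μ x * (W x * (χ x ^ 2 * ‖u x‖ ^ 2)) : ℝ) : ℂ)
      + ((ν * ∑ x ∈ F, μ x * (χ x ^ 2 * ‖u x‖ ^ 2) : ℝ) : ℂ) * Complex.I := by
      rw [mul_sum, ← sum_neg_distrib, Complex.ofReal_sum, Complex.ofReal_sum, sum_mul,
        ← sum_add_distrib]
      refine sum_congr rfl fun x hx => ?_
      by_cases h0 : χ x = 0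
      · simp [h0]
      · rw [hu x hx h0, star_mul', Complex.star_def, Complex.conj_ofReal]
        have := hcs (u x)
        rw [Complex.star_def] at this
        push_cast at this ⊢
        linear_combination ((χ x : ℂ) ^ 2 * (μ x : ℂ) * ((ν : ℂ) * Complex.I - (W x : ℂ))) * this
    have hr : ∑ x ∈ F, ∑ y ∈ F, (w x y : ℂ) * (v x * star (((χ x ^ 2 : ℝ) : ℂ) * u x
        - e x y * (((χ y ^ 2 : ℝ) : ℂ) * u y))) = (X : ℂ) + Z := by
      rw [hXdef, hZ, Complex.ofReal_sum, ← sum_add_distrib]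
      refine sum_congr rfl fun x hx => ?_
      have h1 : ((μ x * (χ x * ‖v x‖) ^ 2 : ℝ) : ℂ) =
          ∑ y ∈ F, (w x y : ℂ) * (((χ x ^ 2 : ℝ) : ℂ) * (v x * star (u x - e x y * u y))) := by
        by_cases h0 : χ x = 0
        · simp [h0]
        · have h2 := congrArg star (hv x hx (hχI x hx h0))
          rw [star_sum] at h2
          have h3 : ∑ y ∈ F, (w x y : ℂ) * (((χ x ^ 2 : ℝ) : ℂ) * (v x * star (u x - e x y * u y)))
              = ((χ x ^ 2 : ℝ) : ℂ) * v x *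
                ∑ y ∈ F, star ((w x y : ℂ) * (u x - e x y * u y)) := by
            rw [mul_sum]
            refine sum_congr rfl fun y _ => ?_
            rw [star_mul', Complex.star_def, Complex.conj_ofReal]
            ring
          rw [h3, ← h2, star_mul', Complex.star_def, Complex.conj_ofReal]
          have := hcs (v x)
          rw [Complex.star_def] at this
          push_cast at this ⊢
          linear_combination (-(χ x : ℂ) ^ 2 * (μ x : ℂ)) * this
      rw [h1, ← sum_add_distrib]
      refine sum_congr rfl fun y _ => ?_
      simp only [star_sub, star_mul', Complex.star_def, Complex.conj_ofReal]
      push_cast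
      ring
    rw [← hr, ← hg, hl]
  have him : ν * ∑ x ∈ F, μ x * (χ x ^ 2 * ‖u x‖ ^ 2) = Z.im := by
    have := congrArg Complex.im hid
    rw [Complex.add_im, Complex.add_im, Complex.ofReal_im, Complex.ofReal_im,
      Complex.im_ofReal_mul, Complex.I_im, zero_add, zero_add, mul_one] at this
    exact this.symm
  have hre : X + Z.re = - ∑ x ∈ F, μ x * (W x * (χ x ^ 2 * ‖u x‖ ^ 2)) := by
    have := congrArg Complex.re hid
    rw [Complex.add_re, Complex.add_re, Complex.ofReal_re, Complex.re_ofReal_mul,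
      Complex.I_re, mul_zero, add_zero, Complex.ofReal_re] at this
    exact this
  have hXE : X ≤ E + Q * S ^ 2 := by
    have h1 : - ∑ x ∈ F, μ x * (W x * (χ x ^ 2 * ‖u x‖ ^ 2)) ≤ Q * S ^ 2 := by
      rw [hS2, mul_sum, ← sum_neg_distrib]
      refine sum_le_sum fun x hx => ?_
      by_cases h0 : χ x = 0
      · simp only [h0]
        have := mul_nonneg hQ (mul_nonneg (hμ x) (sq_nonneg ‖u x‖))
        simpa using this
      · have h2 := hW x hx h0
        have h3 : χ x ^ 2 ≤ 1 := pow_le_one₀ (hχ0 x) (hχ1 x)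
        have h4 : 0 ≤ μ x * ‖u x‖ ^ 2 := mul_nonneg (hμ x) (sq_nonneg _)
        have h5 : -W x * χ x ^ 2 ≤ Q := by nlinarith [sq_nonneg (χ x)]
        nlinarith
    have h2 : -Z.re ≤ E := (neg_le_abs _).trans ((Complex.abs_re_le_norm Z).trans hZE)
    linarith
  have hνE : |ν| * ∑ x ∈ F, μ x * (χ x ^ 2 * ‖u x‖ ^ 2) ≤ E := by
    rw [← abs_of_nonneg (sum_nonneg fun x _ => mul_nonneg (hμ x) (by positivity) :
      0 ≤ ∑ x ∈ F, μ x * (χ x ^ 2 * ‖u x‖ ^ 2)), ← abs_mul, him]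
    exact (Complex.abs_im_le_norm Z).trans hZE
  refine hνE.trans ?_
  set Y := √(∑ x ∈ F, μ x * (if I x then ‖v x‖ else 0) ^ 2) with hYdef
  have hY2 : Y ^ 2 = ∑ x ∈ F, μ x * (if I x then ‖v x‖ else 0) ^ 2 :=
    Real.sq_sqrt (sum_nonneg fun x _ => mul_nonneg (hμ x) (sq_nonneg _))
  have hY : Y ≤ 2 * C * S := by
    have h1 : Y ^ 2 ≤ C * (Y * S) + C * Y * S := by
      calc Y ^ 2 ≤ ∑ x ∈ F, (C * (μ x * ((if I x then ‖v x‖ else 0) * ‖u x‖)) +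
            ∑ y ∈ F, w x y * ((if I x then ‖v x‖ else 0) * ‖u y‖)) := by
            rw [hY2]
            refine sum_le_sum fun x hx => ?_
            by_cases hI : I x
            · simp only [hI, if_true]
              have h2 := congrArg norm (hv x hx hI)
              rw [norm_mul, Complex.norm_real, Real.norm_eq_abs, abs_of_nonneg (hμ x)] at h2
              have h3 : μ x * ‖v x‖ ≤ ∑ y ∈ F, w x y * (‖u x‖ + ‖u y‖) := by
                rw [h2]
                refine (norm_sum_le _ _).trans (sum_le_sum fun y _ => ?_)
                rw [norm_mul, Complex.norm_real, Real.norm_eq_abs, abs_of_nonneg (hw0 x y)]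
                refine mul_le_mul_of_nonneg_left ((norm_sub_le _ _).trans ?_) (hw0 x y)
                rw [norm_mul, he1, one_mul]
              have h4 : ∑ y ∈ F, w x y * (‖u x‖ + ‖u y‖) ≤
                  C * μ x * ‖u x‖ + ∑ y ∈ F, w x y * ‖u y‖ := by
                simp only [mul_add, sum_add_distrib, ← sum_mul]
                gcongr
                exact hrow x hx
              have h5 : ∑ y ∈ F, w x y * (‖v x‖ * ‖u y‖) = ‖v x‖ * ∑ y ∈ F, w x y * ‖u y‖ := by
                rw [mul_sum]
                exact sum_congr rfl fun y _ => by ring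
              rw [h5]
              nlinarith [mul_le_mul_of_nonneg_left (h3.trans h4) (norm_nonneg (v x))]
            · simp [hI]
        _ ≤ _ := by
            rw [sum_add_distrib, ← mul_sum]
            gcongr
            · exact sum_weight_mul_le_sqrt_mul_sqrt F μ _ _ hμ
            · exact sum_sum_mul_le_of_schur F w μ _ _ C hw0 hμ hC hrow hcol
    rcases (show 0 ≤ Y from Real.sqrt_nonneg _).eq_or_lt with h0 | h0
    · rw [← h0]
      positivity
    · nlinarith
  refine le_of_commutator_estimate hE0 (mul_nonneg hC hε) (Real.sqrt_nonneg _)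
    (Real.sqrt_nonneg _) hQ hXE ?_
  have hpt : ∀ x y, w x y * (|χ x ^ 2 - χ y ^ 2| * (‖v x‖ * ‖u y‖)) ≤
      2 * ε * (w x y * ((χ x * ‖v x‖) * (if J y then ‖u y‖ else 0))) +
      ε ^ 2 * (w x y * ((if I x then ‖v x‖ else 0) * (if J y then ‖u y‖ else 0))) := by
    intro x y
    have hrhs : 0 ≤ 2 * ε * (w x y * ((χ x * ‖v x‖) * (if J y then ‖u y‖ else 0))) +
        ε ^ 2 * (w x y * ((if I x then ‖v x‖ else 0) * (if J y then ‖u y‖ else 0))) := by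
      have := hw0 x y
      have := hχ0 x
      positivity
    by_cases h0 : w x y = 0
    · simp [h0]
    by_cases h1 : χ x = χ y
    · simpa [h1] using hrhs
    obtain ⟨hI, hJ⟩ := hχIJ x y h0 h1
    simp only [hI, hJ, if_true]
    have h2 : |χ x ^ 2 - χ y ^ 2| ≤ 2 * ε * χ x + ε ^ 2 := by
      have h3 := hχε x y h0
      have h4 : χ x ^ 2 - χ y ^ 2 = 2 * χ x * (χ x - χ y) - (χ x - χ y) ^ 2 := by ring
      rw [h4]
      refine (abs_sub _ _).trans ?_
      rw [abs_mul, abs_of_nonneg (by have := hχ0 x; positivity : 0 ≤ 2 * χ x), abs_pow]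
      have h5 : |χ x - χ y| ^ 2 ≤ ε ^ 2 := by gcongr
      nlinarith [mul_le_mul_of_nonneg_left h3 (hχ0 x)]
    have h6 : 0 ≤ w x y * (‖v x‖ * ‖u y‖) := mul_nonneg (hw0 x y) (by positivity)
    nlinarith [mul_le_mul_of_nonneg_right h2 h6]
  calc E ≤ 2 * ε * (∑ x ∈ F, ∑ y ∈ F,
          w x y * ((χ x * ‖v x‖) * (if J y then ‖u y‖ else 0))) +
        ε ^ 2 * (∑ x ∈ F, ∑ y ∈ F,
          w x y * ((if I x then ‖v x‖ else 0) * (if J y then ‖u y‖ else 0))) := by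
        simp only [mul_sum, ← sum_add_distrib]
        exact sum_le_sum fun x _ => sum_le_sum fun y _ => hpt x y
    _ ≤ 2 * ε * (C * √X * s) + ε ^ 2 * (C * Y * s) := by
        gcongr
        · exact sum_sum_mul_le_of_schur F w μ _ _ C hw0 hμ hC hrow hcol
        · exact sum_sum_mul_le_of_schur F w μ _ _ C hw0 hμ hC hrow hcol
    _ ≤ 2 * ε * (C * √X * s) + ε ^ 2 * (C * (2 * C * S) * s) := by gcongr
    _ = _ := by ring

lemma finite_dist_le {V : Type*} (G : SimpleGraph V) (hG : ∀ x, {y | G.Adj x y}.Finite)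
    (hconn : G.Connected) (x₀ : V) (n : ℕ) : {x | G.dist x₀ x ≤ n}.Finite := by
  induction n with
  | zero =>
    refine (Set.finite_singleton x₀).subset fun x hx => ?_
    exact (hconn.dist_eq_zero_iff.1 (Nat.le_zero.1 hx)).symm
  | succ n ih =>
    refine ((Set.finite_singleton x₀).union (ih.biUnion fun x _ => hG x)).subset fun y hy => ?_
    by_cases h0 : G.dist x₀ y = 0
    · exact Or.inl (hconn.dist_eq_zero_iff.1 h0).symm
    · right
      obtain ⟨p, hp⟩ := hconn.exists_walk_length_eq_dist y x₀
      cases p with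
      | nil => simp at h0
      | cons h p =>
        rename_i z
        refine Set.mem_biUnion (x := z) ?_ h.symm
        have h1 := SimpleGraph.dist_le p
        simp only [SimpleGraph.Walk.length_cons] at hp
        rw [SimpleGraph.dist_comm] at hp h1
        have hy : G.dist x₀ y ≤ n + 1 := hy
        show G.dist x₀ z ≤ n
        omega

section cutoff

variable {V : Type*} (r : V → ℕ) {n : ℕ} (x y : V)

lemma cutoff_nonneg : 0 ≤ cutoff r n x := le_min (le_max_right _ _) zero_le_one

lemma cutoff_le_one : cutoff r n x ≤ 1 := min_le_right _ _

variable {r x}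

lemma cutoff_eq_one (hn : 0 < n) (h : r x ≤ n) : cutoff r n x = 1 := by
  have hn' : (0 : ℝ) < n := by exact_mod_cast hn
  have h' : (r x : ℝ) ≤ n := by exact_mod_cast h
  refine min_eq_right (le_max_of_le_left ?_)
  rw [le_div_iff₀ hn']
  linarith

lemma cutoff_eq_zero (h : 2 * n ≤ r x) : cutoff r n x = 0 := by
  have h' : 2 * (n : ℝ) ≤ r x := by exact_mod_cast h
  unfold cutoff
  rw [max_eq_right (div_nonpos_of_nonpos_of_nonneg (by linarith) (Nat.cast_nonneg n)),
    min_eq_left zero_le_one]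

variable {y}

lemma abs_cutoff_sub_le (hxy : r x ≤ r y + 1) (hyx : r y ≤ r x + 1) :
    |cutoff r n x - cutoff r n y| ≤ 1 / n := by
  have h1 : (r x : ℝ) ≤ r y + 1 := by exact_mod_cast hxy
  have h2 : (r y : ℝ) ≤ r x + 1 := by exact_mod_cast hyx
  refine (abs_min_sub_min_le_max _ _ _ _).trans (max_le ?_ (by simp))
  refine (abs_max_sub_max_le_abs _ _ _).trans ?_
  rw [← sub_div, abs_div, Nat.abs_cast]
  gcongr
  rw [abs_le]
  constructor <;> linarith

end cutoff

open Filter Topology in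
lemma tendsto_tsum_ite_le_zero {V : Type*} (f : V → ℝ) (r : V → ℕ) (hf : Summable f)
    (hf0 : ∀ x, 0 ≤ f x) :
    Tendsto (fun n : ℕ => ∑' x, if n ≤ r x then f x else 0) atTop (𝓝 0) := by
  have h := tendsto_tsum_of_dominated_convergence (𝓕 := atTop)
    (f := fun (n : ℕ) x => if n ≤ r x then f x else 0) (g := fun _ => (0 : ℝ)) hf ?_ ?_
  · simpa using h
  · intro x
    refine tendsto_const_nhds.congr' ?_
    filter_upwards [eventually_gt_atTop (r x)] with n hn
    rw [if_neg (by omega)]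
  · refine Eventually.of_forall fun n x => ?_
    split_ifs
    · rw [Real.norm_of_nonneg (hf0 x)]
    · simpa using hf0 x

/-- Growth of `d_n p_n` against `q`, in the form used for the cut-off at radius `n`. -/
lemma exists_growth_bound {μ₀ α : ℝ} {D P : ℕ → ℝ} {q : ℝ → ℝ} (hμ0 : 0 < μ₀)
    (hα0 : 0 ≤ α) (hα1 : α ≤ 1) (hqO : ∃ c s₀ : ℝ, ∀ s : ℝ, s₀ ≤ s → q s ≤ c * s ^ α)
    (hDP : ∃ (M : ℝ) (N : ℕ), ∀ n : ℕ, N ≤ n → (n : ℝ) ^ (α - 1) * (D n * P n) ≤ M) :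
    ∃ (A : ℝ) (N : ℕ), 0 ≤ A ∧ ∀ n : ℕ, N ≤ n → 0 ≤ D (2 * n + 1) * P (2 * n + 1) →
      D (2 * n + 1) * P (2 * n + 1) / μ₀ * (1 / n) ≤ A ∧
      D (2 * n + 1) * P (2 * n + 1) / μ₀ * (1 / n) * √(q (2 * n)) ≤ A := by
  obtain ⟨c, s₀, hc⟩ := hqO
  obtain ⟨M, N, hM⟩ := hDP
  set B := 3 * |M| / μ₀ with hB
  have hB0 : 0 ≤ B := by positivity
  refine ⟨max B √(B ^ 2 * (2 * |c|)), max 1 (max N ⌈s₀⌉₊), hB0.trans (le_max_left _ _), ?_⟩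
  intro n hn h0
  simp only [max_le_iff] at hn
  obtain ⟨hn1, hnN, hns⟩ := hn
  have hn1' : (1 : ℝ) ≤ n := by exact_mod_cast hn1
  have hn0 : (0 : ℝ) < n := by linarith
  have hs : s₀ ≤ 2 * (n : ℝ) := by
    have : s₀ ≤ n := (Nat.le_ceil s₀).trans (by exact_mod_cast hns)
    linarith
  set d := D (2 * n + 1) * P (2 * n + 1) with hd
  have hdM : d ≤ |M| * (3 * n * (n : ℝ) ^ (-α)) := by
    have h1 := (hM (2 * n + 1) (by omega)).trans (le_abs_self M)
    set m : ℝ := ((2 * n + 1 : ℕ) : ℝ) with hm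
    have hm0 : 0 < m := by rw [hm]; positivity
    have hmn : (n : ℝ) ≤ m := by rw [hm]; push_cast; linarith
    have hm3 : m ≤ 3 * n := by rw [hm]; push_cast; linarith
    have h2 : d = (m ^ (α - 1) * d) * m ^ (1 - α) := by
      rw [mul_right_comm, ← Real.rpow_add hm0]
      simp
    have h3 : m ^ (1 - α) ≤ 3 * n * (n : ℝ) ^ (-α) := by
      rw [sub_eq_add_neg, Real.rpow_add hm0, Real.rpow_one]
      exact mul_le_mul hm3 (Real.rpow_le_rpow_of_nonpos hn0 hmn (by linarith))
        (by positivity) (by positivity)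
    rw [h2]
    exact mul_le_mul h1 h3 (by positivity) (abs_nonneg _)
  have ha : d / μ₀ * (1 / n) ≤ B * (n : ℝ) ^ (-α) := by
    rw [div_mul_div_comm, mul_one, div_le_iff₀ (by positivity), hB]
    calc d ≤ _ := hdM
      _ = _ := by field_simp
  have ha0 : 0 ≤ d / μ₀ * (1 / n) := by positivity
  have hnα : (n : ℝ) ^ (-α) ≤ 1 := Real.rpow_le_one_of_one_le_of_nonpos hn1' (by linarith)
  have hnα0 : 0 ≤ (n : ℝ) ^ (-α) := by positivity
  have haB : d / μ₀ * (1 / n) ≤ B := ha.trans (by nlinarith)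
  refine ⟨haB.trans (le_max_left _ _), le_trans ?_ (le_max_right _ _)⟩
  have hq : q (2 * n) ≤ 2 * |c| * (n : ℝ) ^ α := by
    have h1 : (2 * (n : ℝ)) ^ α ≤ 2 * (n : ℝ) ^ α := by
      rw [Real.mul_rpow (by norm_num) hn0.le]
      gcongr
      calc (2 : ℝ) ^ α ≤ 2 ^ (1 : ℝ) := Real.rpow_le_rpow_of_exponent_le (by norm_num) hα1
        _ = 2 := Real.rpow_one 2
    calc q (2 * n) ≤ c * (2 * (n : ℝ)) ^ α := hc _ hs
      _ ≤ |c| * (2 * (n : ℝ) ^ α) := by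
        gcongr
        exact le_abs_self c
      _ = _ := by ring
  calc d / μ₀ * (1 / n) * √(q (2 * n))
      ≤ (B * (n : ℝ) ^ (-α)) * √(2 * |c| * (n : ℝ) ^ α) := by gcongr
    _ = √((B * (n : ℝ) ^ (-α)) ^ 2 * (2 * |c| * (n : ℝ) ^ α)) := by
        rw [Real.sqrt_mul (sq_nonneg _), Real.sqrt_sq (by positivity)]
    _ ≤ _ := by
        refine Real.sqrt_le_sqrt ?_
        have h1 : (n : ℝ) ^ (-α) * (n : ℝ) ^ α = 1 := by
          rw [← Real.rpow_add hn0]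
          simp
        calc (B * (n : ℝ) ^ (-α)) ^ 2 * (2 * |c| * (n : ℝ) ^ α)
            = B ^ 2 * (2 * |c|) * (n : ℝ) ^ (-α) * ((n : ℝ) ^ (-α) * (n : ℝ) ^ α) := by ring
          _ = B ^ 2 * (2 * |c|) * (n : ℝ) ^ (-α) := by rw [h1, mul_one]
          _ ≤ _ := mul_le_of_le_one_right (by positivity) hnα

open Finset in
lemma sum_weight_le_of_card_le {V : Type*} (F : Finset V) (b : V → V → ℝ) (x : V) (d p : ℝ)
    (hb : ∀ y, 0 ≤ b x y) (hfin : {y | 0 < b x y}.Finite)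
    (hd : ({y | 0 < b x y}.ncard : ℝ) ≤ d) (hp : ∀ y, b x y ≤ p) (hp0 : 0 ≤ p) :
    ∑ y ∈ F, b x y ≤ d * p := by
  classical
  have h1 : ∑ y ∈ F, b x y = ∑ y ∈ F with 0 < b x y, b x y := by
    rw [sum_filter]
    refine sum_congr rfl fun y _ => ?_
    split_ifs with h
    · rfl
    · exact le_antisymm (not_lt.1 h) (hb y)
  have h2 : #{y ∈ F | 0 < b x y} ≤ {y | 0 < b x y}.ncard := by
    rw [← Set.ncard_coe_finset]
    exact Set.ncard_le_ncard (fun y hy => (mem_filter.1 hy).2) hfin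
  rw [h1]
  refine (sum_le_card_nsmul _ _ p fun y _ => hp y).trans ?_
  rw [nsmul_eq_mul]
  gcongr
  exact le_trans (by exact_mod_cast h2) hd

/-- Main theorem: under the stated hypotheses on the weighted graph `(V,b,μ)`, the
potential `W ≥ −q∘r` with `q` non-decreasing and `q(s) = O(s^α)`, `0 ≤ α ≤ 1`, and the
growth conditions on `d_n p_n`, the operator `H = Δ_θ² + W` is essentially self-adjoint
on `C_c(V)` in `ℓ²(V,μ)`.

Essential self-adjointness of the symmetric operator `H|_{C_c(V)}` is formalized via the
standard deficiency-index criterion: since `(H|_{C_c(V)})* = H_max`, it is equivalent to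
the statement that for every `ν ≠ 0`, the only `u ∈ ℓ²(V,μ)` with `Hu ∈ ℓ²(V,μ)` and
`Hu = iνu` is `u = 0`. -/
theorem biLaplacian_essentially_selfAdjoint {V : Type*} [Countable V]
    (μ : V → ℝ) (μ₀ : ℝ) (b : V → V → ℝ) (θ : V → V → ℝ)
    (G : SimpleGraph V) (x₀ : V) (D P : ℕ → ℝ) (α : ℝ)
    (hμ0 : 0 < μ₀) (hμ : ∀ x, μ₀ ≤ μ x)
    (hbsymm : ∀ x y, b x y = b y x) (hbnn : ∀ x y, 0 ≤ b x y) (hbdiag : ∀ x, b x x = 0)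
    (hloc : ∀ x, {y | 0 < b x y}.Finite)
    (hG : ∀ x y, G.Adj x y ↔ 0 < b x y) (hconn : G.Connected)
    (hθ : ∀ x y, θ x y = -θ y x) (hθbd : ∀ x y, |θ x y| ≤ Real.pi)
    (hD : ∀ (m : ℕ) (x : V), G.dist x₀ x ≤ m → ({y | 0 < b x y}.ncard : ℝ) ≤ D m)
    (hP : ∀ (m : ℕ) (x y : V), G.dist x₀ x ≤ m → b x y ≤ P m)
    (hα0 : 0 ≤ α) (hα1 : α ≤ 1)
    (q : ℝ → ℝ) (hqpos : ∀ s, 0 ≤ s → 0 < q s)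
    (hqmono : ∀ s t, 0 ≤ s → s ≤ t → q s ≤ q t)
    (hqO : ∃ c s₀ : ℝ, ∀ s : ℝ, s₀ ≤ s → q s ≤ c * s ^ α)
    (W : V → ℝ) (hW : ∀ x, -q (G.dist x₀ x) ≤ W x)
    (hcase_pos : 0 < α → ∃ M : ℝ, ∀ n : ℕ, 1 ≤ n → (n : ℝ) ^ (α - 1) * D n * P n ≤ M)
    (hcase_zero : α = 0 → ∃ (K : ℝ) (N : ℕ), 0 < K ∧ K < μ₀ / 2 ∧
      ∀ n : ℕ, N ≤ n → D n * P n / n ≤ K) :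
    ∀ ν : ℝ, ν ≠ 0 → ∀ u : V → ℂ,
      (Summable fun x => μ x * ‖u x‖ ^ 2) →
      (Summable fun x =>
        μ x * ‖magLap μ b θ (magLap μ b θ u) x + (W x : ℂ) * u x‖ ^ 2) →
      (∀ x, magLap μ b θ (magLap μ b θ u) x + (W x : ℂ) * u x
        = (ν : ℂ) * Complex.I * u x) →
      u = 0 := by
  intro ν hν u hu _ hHu
  set r : V → ℕ := fun x => G.dist x₀ x with hr
  have hμpos : ∀ x, 0 < μ x := fun x => hμ0.trans_le (hμ x)
  have hadj : ∀ x y, b x y ≠ 0 → r y ≤ r x + 1 := by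
    intro x y hxy
    have h1 : G.Adj x y := (hG x y).2 (lt_of_le_of_ne (hbnn x y) (Ne.symm hxy))
    have h2 := hconn.dist_triangle (u := x₀) (v := x) (w := y)
    rw [SimpleGraph.dist_eq_one_iff_adj.2 h1] at h2
    exact h2
  have hadj' : ∀ x y, b x y ≠ 0 → r x ≤ r y + 1 := fun x y hxy =>
    hadj y x (by rwa [hbsymm])
  have hball : ∀ n, {x | r x ≤ n}.Finite :=
    finite_dist_le G (fun x => by simpa only [hG] using hloc x) hconn x₀
  have hr0 : ∀ m, r x₀ ≤ m := by simp [hr]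
  have hD0 : ∀ m, 0 ≤ D m := fun m => (Nat.cast_nonneg _).trans (hD m x₀ (hr0 m))
  have hP0 : ∀ m, 0 ≤ P m := fun m => (hbnn x₀ x₀).trans (hP m x₀ x₀ (hr0 m))
  have hDP : ∃ (M : ℝ) (N : ℕ), ∀ n : ℕ, N ≤ n → (n : ℝ) ^ (α - 1) * (D n * P n) ≤ M := by
    rcases hα0.eq_or_lt with h | h
    · obtain ⟨K, N, -, -, hK⟩ := hcase_zero h.symm
      refine ⟨K, N, fun n hn => ?_⟩
      rw [← h, zero_sub, Real.rpow_neg_one, mul_comm, ← div_eq_mul_inv]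
      exact hK n hn
    · obtain ⟨M, hM⟩ := hcase_pos h
      refine ⟨M, 1, fun n hn => ?_⟩
      rw [← mul_assoc]
      exact hM n hn
  obtain ⟨A, N, hA0, hA⟩ := exists_growth_bound hμ0 hα0 hα1 hqO hDP
  set T := √(∑' x, μ x * ‖u x‖ ^ 2) with hT
  set s : ℕ → ℝ := fun n => √(∑' x, if n ≤ r x then μ x * ‖u x‖ ^ 2 else 0) with hs
  have hterm : ∀ x, 0 ≤ μ x * ‖u x‖ ^ 2 := fun x => mul_nonneg (hμpos x).le (sq_nonneg _)
  have hs0 : Filter.Tendsto s Filter.atTop (nhds 0) := by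
    have := (tendsto_tsum_ite_le_zero _ r hu hterm).sqrt
    rwa [Real.sqrt_zero] at this
  set e : V → V → ℂ := fun x y => Complex.exp (Complex.I * (θ x y : ℝ)) with he
  have he1 : ∀ x y, ‖e x y‖ = 1 := by
    intro x y
    simp only [he]
    rw [mul_comm, Complex.norm_exp_ofReal_mul_I]
  have hestar : ∀ x y, e y x = star (e x y) := by
    intro x y
    simp only [he, Complex.star_def]
    rw [← Complex.exp_conj, hθ y x]
    simp
  have hmag : ∀ (F : Finset V) (f : V → ℂ) (x : V), (∀ y, b x y ≠ 0 → y ∈ F) →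
      ∑ y ∈ F, (b x y : ℂ) * (f x - e x y * f y) = (μ x : ℂ) * magLap μ b θ f x := by
    intro F f x hF
    have h0 : (μ x : ℂ) ≠ 0 := by exact_mod_cast (hμpos x).ne'
    rw [magLap, mul_inv_cancel_left₀ h0, tsum_eq_sum]
    intro y hy
    have : b x y = 0 := by
      by_contra h
      exact hy (hF y h)
    simp [this]
  have hkey : ∀ x n, max (max N 1) (r x) ≤ n → |ν| * (μ x * ‖u x‖ ^ 2) ≤
      (4 * A ^ 2 * T + 4 * A * T + 4 * A ^ 2 * T) * s n := by
    intro x n hn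
    simp only [max_le_iff] at hn
    obtain ⟨⟨hnN, hn1⟩, hnx⟩ := hn
    set F := (hball (2 * n + 1)).toFinset with hFdef
    have hF : ∀ y, y ∈ F ↔ r y ≤ 2 * n + 1 := fun y => by simp [hFdef]
    set C := D (2 * n + 1) * P (2 * n + 1) / μ₀ with hCdef
    have hDPn : 0 ≤ D (2 * n + 1) * P (2 * n + 1) := mul_nonneg (hD0 _) (hP0 _)
    have hC0 : 0 ≤ C := div_nonneg hDPn hμ0.le
    obtain ⟨hA1, hA2⟩ := hA n hnN hDPn
    have hnbr : ∀ x, r x ≤ 2 * n → ∀ y, b x y ≠ 0 → y ∈ F := by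
      intro x hx y hxy
      have := hadj x y hxy
      rw [hF]
      omega
    have hsupp : ∀ x, cutoff r n x ≠ 0 → r x ≤ 2 * n := by
      intro x hx
      by_contra h
      exact hx (cutoff_eq_zero (by omega))
    have hq0 : 0 < q (2 * n) := hqpos _ (by positivity)
    have hmain := abs_mul_sum_cutoff_le F b e μ W (cutoff r n) u (magLap μ b θ u)
      (fun x => r x ≤ 2 * n) (fun x => n ≤ r x) C (1 / n) (q (2 * n)) ν hbsymm hbnn hestar he1
      (fun x => (hμpos x).le) hC0 (by positivity) hq0.le ?_
      (cutoff_nonneg r) (cutoff_le_one r) (fun x _ => hsupp x)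
      (fun x y hxy => abs_cutoff_sub_le (hadj' x y hxy) (hadj x y hxy)) ?_ ?_ ?_ ?_
    rotate_left
    · intro x hx
      rw [hF] at hx
      refine (sum_weight_le_of_card_le F b x _ _ (hbnn x) (hloc x) (hD _ x hx)
        (fun y => hP _ x y hx) (hP0 _)).trans ?_
      rw [hCdef, div_mul_eq_mul_div, le_div_iff₀ hμ0]
      exact mul_le_mul_of_nonneg_left (hμ x) hDPn
    · intro x y hxy hne
      have h1 := hadj x y hxy
      have h2 := hadj' x y hxy
      constructor
      · by_contra h
        exact hne (by rw [cutoff_eq_zero (x := x) (by omega), cutoff_eq_zero (x := y) (by omega)])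
      · by_contra h
        exact hne (by rw [cutoff_eq_one (x := x) (by omega) (by omega),
          cutoff_eq_one (x := y) (by omega) (by omega)])
    · intro x _ hx
      exact (hmag F u x (hnbr x hx)).symm
    · intro x _ hx
      rw [hmag F _ x (hnbr x (hsupp x hx)), mul_assoc]
      congr 1
      linear_combination hHu x
    · intro x _ hx
      refine le_trans (neg_le_neg ?_) (hW x)
      exact hqmono _ _ (Nat.cast_nonneg _) (by exact_mod_cast hsupp x hx)
    set σ := √(∑ x ∈ F, μ x * (if n ≤ r x then ‖u x‖ else 0) ^ 2) with hσ
    set S := √(∑ x ∈ F, μ x * ‖u x‖ ^ 2) with hS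
    have hST : S ≤ T := Real.sqrt_le_sqrt (hu.sum_le_tsum F fun x _ => hterm x)
    have hite : ∀ x, μ x * (if n ≤ r x then ‖u x‖ else 0) ^ 2 =
        if n ≤ r x then μ x * ‖u x‖ ^ 2 else 0 := by
      intro x
      split_ifs <;> simp
    have hite0 : ∀ x, 0 ≤ (if n ≤ r x then μ x * ‖u x‖ ^ 2 else 0) := by
      intro x
      split_ifs
      exacts [hterm x, le_rfl]
    have hitele : ∀ x, (if n ≤ r x then μ x * ‖u x‖ ^ 2 else 0) ≤ μ x * ‖u x‖ ^ 2 := by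
      intro x
      split_ifs
      exacts [le_rfl, hterm x]
    have hσs : σ ≤ s n := by
      refine Real.sqrt_le_sqrt ?_
      simp only [hite]
      exact (Summable.of_nonneg_of_le hite0 hitele hu).sum_le_tsum F fun x _ => hite0 x
    have hσS : σ ≤ S := by
      refine Real.sqrt_le_sqrt (Finset.sum_le_sum fun x _ => ?_)
      rw [hite]
      exact hitele x
    have hσ0 : 0 ≤ σ := Real.sqrt_nonneg _
    have hS0 : 0 ≤ S := Real.sqrt_nonneg _
    have hT0 : 0 ≤ T := Real.sqrt_nonneg _
    have ha0 : 0 ≤ C * (1 / n) := by positivity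
    calc |ν| * (μ x * ‖u x‖ ^ 2)
        ≤ |ν| * ∑ x ∈ F, μ x * (cutoff r n x ^ 2 * ‖u x‖ ^ 2) := by
          gcongr
          have h1 := Finset.single_le_sum (s := F)
            (f := fun x => μ x * (cutoff r n x ^ 2 * ‖u x‖ ^ 2))
            (fun x _ => mul_nonneg (hμpos x).le (by positivity)) ((hF x).2 (by omega))
          simpa [cutoff_eq_one (r := r) (x := x) hn1 hnx] using h1
      _ ≤ _ := hmain
      _ = 4 * (C * (1 / n)) ^ 2 * σ * σ + 4 * (C * (1 / n) * √(q (2 * n))) * S * σ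
          + 4 * (C * (1 / n)) ^ 2 * S * σ := by ring
      _ ≤ 4 * A ^ 2 * T * s n + 4 * A * T * s n + 4 * A ^ 2 * T * s n := by
          have hσT := hσS.trans hST
          gcongr
      _ = _ := by ring
  funext x
  have hlim := (hs0.const_mul (4 * A ^ 2 * T + 4 * A * T + 4 * A ^ 2 * T))
  rw [mul_zero] at hlim
  have hle := ge_of_tendsto hlim (Filter.eventually_atTop.2 ⟨_, hkey x⟩)
  by_contra hx
  have : 0 < |ν| * (μ x * ‖u x‖ ^ 2) :=
    mul_pos (abs_pos.2 hν) (mul_pos (hμpos x) (pow_pos (norm_pos_iff.2 hx) 2))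
  linarith
end

section
/- For a radial tree rooted at x_0 in which every vertex at distance n from the root has ⌊n^κ⌋ + 1 children (0 ≤ κ < 1), with unit edge and vertex weights, and potential W(x) = −n^α for x at distance n where 0 < α ≤ 1−κ, the operator Δ²u + Wu is essentially self-adjoint on finitely supported functions in ℓ²(V). -/
open scoped Classical in
/-- The graph Laplacian of a simple graph with unit edge and vertex weights:
`(Δu)(x) = Σ_{y∼x} (u x − u y)`. -/
noncomputable def graphLap {V : Type*} (G : SimpleGraph V) (u : V → ℂ) (x : V) : ℂ :=
  ∑' y, (if G.Adj x y then (1 : ℂ) else 0) * (u x - u y)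

/-- The weighted graph Laplacian restricted to a finite set of vertices. -/
noncomputable def finLap {V : Type*} (T : Finset V) (A : V → V → ℝ) (u : V → ℂ) (x : V) : ℂ :=
  ∑ y ∈ T, (A x y : ℂ) * (u x - u y)

section FiniteEstimates

variable {V : Type*} {T : Finset V} {A : V → V → ℝ} {D : ℝ}

theorem sum_mul_finLap_comm (hA : ∀ x y, A x y = A y x) (g v : V → ℂ) :
    ∑ x ∈ T, g x * finLap T A v x = ∑ x ∈ T, v x * finLap T A g x := by
  have hswap : ∑ x ∈ T, ∑ y ∈ T, (A x y : ℂ) * (g x * v y)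
      = ∑ x ∈ T, ∑ y ∈ T, (A x y : ℂ) * (v x * g y) := by
    rw [Finset.sum_comm]
    refine Finset.sum_congr rfl fun x _ => Finset.sum_congr rfl fun y _ => ?_
    rw [hA y x]; ring
  have expand : ∀ g v : V → ℂ, ∑ x ∈ T, g x * finLap T A v x
      = ∑ x ∈ T, ∑ y ∈ T, (A x y : ℂ) * (g x * v x)
        - ∑ x ∈ T, ∑ y ∈ T, (A x y : ℂ) * (g x * v y) := by
    intro g v
    simp only [finLap, Finset.mul_sum, ← Finset.sum_sub_distrib]
    exact Finset.sum_congr rfl fun x _ => Finset.sum_congr rfl fun y _ => by ring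
  rw [expand, expand, hswap]
  simp only [mul_comm]

theorem sum_sum_weight_mul_left_le (hD : ∀ x ∈ T, ∑ y ∈ T, A x y ≤ D) {b : V → ℝ}
    (hb : ∀ x, 0 ≤ b x) : ∑ x ∈ T, ∑ y ∈ T, A x y * b x ≤ D * ∑ x ∈ T, b x := by
  rw [Finset.mul_sum]
  refine Finset.sum_le_sum fun x hx => ?_
  rw [← Finset.sum_mul]
  exact mul_le_mul_of_nonneg_right (hD x hx) (hb x)

theorem sum_sum_weight_mul_right_le (hA : ∀ x y, A x y = A y x)
    (hD : ∀ x ∈ T, ∑ y ∈ T, A x y ≤ D) {b : V → ℝ}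
    (hb : ∀ x, 0 ≤ b x) : ∑ x ∈ T, ∑ y ∈ T, A x y * b y ≤ D * ∑ x ∈ T, b x := by
  rw [Finset.sum_comm]
  simp only [fun x y => hA y x]
  exact sum_sum_weight_mul_left_le (fun x hx => by simpa only [hA x] using hD x hx) hb

theorem sum_norm_finLap_sq_le (hA : ∀ x y, A x y = A y x) (hA0 : ∀ x y, 0 ≤ A x y)
    (hD0 : 0 ≤ D) (hD : ∀ x ∈ T, ∑ y ∈ T, A x y ≤ D) (u : V → ℂ) :
    ∑ x ∈ T, ‖finLap T A u x‖ ^ 2 ≤ 4 * D ^ 2 * ∑ x ∈ T, ‖u x‖ ^ 2 := by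
  have pointwise : ∀ x ∈ T, ‖finLap T A u x‖ ^ 2
      ≤ D * ∑ y ∈ T, A x y * (2 * (‖u x‖ ^ 2 + ‖u y‖ ^ 2)) := by
    intro x hx
    have h1 : ‖finLap T A u x‖ ≤ ∑ y ∈ T, A x y * (‖u x‖ + ‖u y‖) := by
      refine (norm_sum_le _ _).trans (Finset.sum_le_sum fun y _ => ?_)
      rw [norm_mul, Complex.norm_real, Real.norm_of_nonneg (hA0 x y)]
      exact mul_le_mul_of_nonneg_left (norm_sub_le _ _) (hA0 x y)
    have h2 : (∑ y ∈ T, A x y * (‖u x‖ + ‖u y‖)) ^ 2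
        ≤ (∑ y ∈ T, A x y) * ∑ y ∈ T, A x y * (‖u x‖ + ‖u y‖) ^ 2 :=
      Finset.sum_sq_le_sum_mul_sum_of_sq_le_mul T (fun y _ => hA0 x y)
        (fun y _ => mul_nonneg (hA0 x y) (sq_nonneg _)) (fun y _ => le_of_eq (by ring))
    have h3 : ∑ y ∈ T, A x y * (‖u x‖ + ‖u y‖) ^ 2
        ≤ ∑ y ∈ T, A x y * (2 * (‖u x‖ ^ 2 + ‖u y‖ ^ 2)) :=
      Finset.sum_le_sum fun y _ => mul_le_mul_of_nonneg_left
        (by nlinarith [sq_nonneg (‖u x‖ - ‖u y‖)]) (hA0 x y)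
    calc ‖finLap T A u x‖ ^ 2 ≤ (∑ y ∈ T, A x y * (‖u x‖ + ‖u y‖)) ^ 2 := by gcongr
      _ ≤ _ := h2
      _ ≤ _ := mul_le_mul (hD x hx) h3
        (Finset.sum_nonneg fun y _ => mul_nonneg (hA0 x y) (sq_nonneg _)) hD0
  refine (Finset.sum_le_sum pointwise).trans ?_
  have hl := sum_sum_weight_mul_left_le hD (b := fun x => ‖u x‖ ^ 2) fun x => sq_nonneg _
  have hr := sum_sum_weight_mul_right_le hA hD (b := fun x => ‖u x‖ ^ 2) fun x => sq_nonneg _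
  have hsplit : ∑ x ∈ T, D * ∑ y ∈ T, A x y * (2 * (‖u x‖ ^ 2 + ‖u y‖ ^ 2))
      = 2 * D * (∑ x ∈ T, ∑ y ∈ T, A x y * ‖u x‖ ^ 2 + ∑ x ∈ T, ∑ y ∈ T, A x y * ‖u y‖ ^ 2) := by
    simp only [Finset.mul_sum, ← Finset.sum_add_distrib]
    exact Finset.sum_congr rfl fun x _ => Finset.sum_congr rfl fun y _ => by ring
  rw [hsplit]
  calc _ ≤ 2 * D * (D * ∑ x ∈ T, ‖u x‖ ^ 2 + D * ∑ x ∈ T, ‖u x‖ ^ 2) := by gcongr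
    _ = _ := by ring

theorem norm_commutator_le (hA : ∀ x y, A x y = A y x) (hA0 : ∀ x y, 0 ≤ A x y)
    (hD0 : 0 < D) (hD : ∀ x ∈ T, ∑ y ∈ T, A x y ≤ D) {φ : V → ℝ} {ε δ : ℝ} (hδ : 0 < δ)
    (hφ0 : ∀ x, 0 ≤ φ x) (hφ : ∀ x y, A x y ≠ 0 → |φ x - φ y| ≤ ε) (u v : V → ℂ) :
    ‖∑ x ∈ T, ∑ y ∈ T, (A x y : ℂ) * ((φ x : ℂ) ^ 2 - (φ y : ℂ) ^ 2) * star (u y) * v x‖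
      ≤ δ * ∑ x ∈ T, φ x ^ 2 * ‖v x‖ ^ 2
        + D ^ 2 * ε ^ 2 * (1 / δ + 1) * ∑ x ∈ T, ‖u x‖ ^ 2
        + ε ^ 2 * ∑ x ∈ T, ‖v x‖ ^ 2 := by
  have pointwise : ∀ x y, ‖(A x y : ℂ) * ((φ x : ℂ) ^ 2 - (φ y : ℂ) ^ 2) * star (u y) * v x‖
      ≤ δ / D * (A x y * (φ x ^ 2 * ‖v x‖ ^ 2)) + D * ε ^ 2 * (1 / δ + 1) * (A x y * ‖u y‖ ^ 2)
        + ε ^ 2 / D * (A x y * ‖v x‖ ^ 2) := by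
    intro x y
    by_cases h0 : A x y = 0
    · simp [h0]
    have hε := hφ x y h0
    have hε0 : 0 ≤ ε := (abs_nonneg _).trans hε
    have hsq : ‖(φ x : ℂ) ^ 2 - (φ y : ℂ) ^ 2‖ ≤ ε * (2 * φ x + ε) := by
      rw [← Complex.ofReal_pow, ← Complex.ofReal_pow, ← Complex.ofReal_sub, Complex.norm_real,
        Real.norm_eq_abs, sq_sub_sq, abs_mul, mul_comm,
        abs_of_nonneg (add_nonneg (hφ0 x) (hφ0 y))]
      have := neg_abs_le (φ x - φ y)
      exact mul_le_mul hε (by linarith) (add_nonneg (hφ0 x) (hφ0 y)) hε0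
    rw [norm_mul, norm_mul, norm_mul, norm_star, Complex.norm_real, Real.norm_of_nonneg (hA0 x y)]
    set a := ‖u y‖
    set b := ‖v x‖
    have ha : 0 ≤ a := norm_nonneg _
    have hb : 0 ≤ b := norm_nonneg _
    have h1 : 2 * ε * φ x * a * b ≤ δ / D * (φ x ^ 2 * b ^ 2) + D * ε ^ 2 / δ * a ^ 2 := by
      have : δ / D * (φ x ^ 2 * b ^ 2) + D * ε ^ 2 / δ * a ^ 2 - 2 * ε * φ x * a * b
          = δ / D * (φ x * b - D * ε / δ * a) ^ 2 := by field_simp; ring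
      have : 0 ≤ δ / D * (φ x * b - D * ε / δ * a) ^ 2 := by positivity
      linarith
    have h2 : a * b ≤ D * a ^ 2 + 1 / D * b ^ 2 := by
      have : D * a ^ 2 + 1 / D * b ^ 2 - 2 * (a * b) = 1 / D * (b - D * a) ^ 2 := by
        field_simp; ring
      have : 0 ≤ 1 / D * (b - D * a) ^ 2 := by positivity
      nlinarith [mul_nonneg ha hb]
    calc A x y * ‖(φ x : ℂ) ^ 2 - (φ y : ℂ) ^ 2‖ * a * b
        ≤ A x y * (ε * (2 * φ x + ε)) * a * b := by gcongr; exact hA0 x y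
      _ = A x y * (2 * ε * φ x * a * b + ε ^ 2 * (a * b)) := by ring
      _ ≤ A x y * (δ / D * (φ x ^ 2 * b ^ 2) + D * ε ^ 2 / δ * a ^ 2
            + ε ^ 2 * (D * a ^ 2 + 1 / D * b ^ 2)) := by
          gcongr; exact hA0 x y
      _ = _ := by ring
  have hs := sum_sum_weight_mul_left_le hD (b := fun x => φ x ^ 2 * ‖v x‖ ^ 2)
    fun x => by positivity
  have hu := sum_sum_weight_mul_right_le hA hD (b := fun x => ‖u x‖ ^ 2) fun x => by positivity
  have hv := sum_sum_weight_mul_left_le hD (b := fun x => ‖v x‖ ^ 2) fun x => by positivity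
  calc _ ≤ ∑ x ∈ T, ∑ y ∈ T, (δ / D * (A x y * (φ x ^ 2 * ‖v x‖ ^ 2))
          + D * ε ^ 2 * (1 / δ + 1) * (A x y * ‖u y‖ ^ 2) + ε ^ 2 / D * (A x y * ‖v x‖ ^ 2)) :=
        (norm_sum_le _ _).trans (Finset.sum_le_sum fun x _ =>
          (norm_sum_le _ _).trans (Finset.sum_le_sum fun y _ => pointwise x y))
    _ = δ / D * (∑ x ∈ T, ∑ y ∈ T, A x y * (φ x ^ 2 * ‖v x‖ ^ 2))
        + D * ε ^ 2 * (1 / δ + 1) * (∑ x ∈ T, ∑ y ∈ T, A x y * ‖u y‖ ^ 2)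
        + ε ^ 2 / D * (∑ x ∈ T, ∑ y ∈ T, A x y * ‖v x‖ ^ 2) := by
        simp only [Finset.sum_add_distrib, Finset.mul_sum]
    _ ≤ δ / D * (D * ∑ x ∈ T, φ x ^ 2 * ‖v x‖ ^ 2)
        + D * ε ^ 2 * (1 / δ + 1) * (D * ∑ x ∈ T, ‖u x‖ ^ 2)
        + ε ^ 2 / D * (D * ∑ x ∈ T, ‖v x‖ ^ 2) := by gcongr
    _ = _ := by field_simp

theorem cutoff_energy_identity (hA : ∀ x y, A x y = A y x) (φ : V → ℝ) (u : V → ℂ) :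
    ∑ x ∈ T, (φ x : ℂ) ^ 2 * star (u x) * finLap T A (finLap T A u) x
      = ((∑ x ∈ T, φ x ^ 2 * ‖finLap T A u x‖ ^ 2 : ℝ) : ℂ)
        + ∑ x ∈ T, ∑ y ∈ T, (A x y : ℂ) * ((φ x : ℂ) ^ 2 - (φ y : ℂ) ^ 2) * star (u y)
            * finLap T A u x := by
  rw [sum_mul_finLap_comm hA (fun x => (φ x : ℂ) ^ 2 * star (u x)), Complex.ofReal_sum,
    ← Finset.sum_add_distrib]
  refine Finset.sum_congr rfl fun x _ => ?_
  have hsq : ((φ x ^ 2 * ‖finLap T A u x‖ ^ 2 : ℝ) : ℂ)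
      = (φ x : ℂ) ^ 2 * star (finLap T A u x) * finLap T A u x := by
    push_cast
    rw [← Complex.conj_mul']
    simp only [starRingEnd_apply]
    ring
  have hstar : star (finLap T A u x) = ∑ y ∈ T, (A x y : ℂ) * (star (u x) - star (u y)) := by
    simp only [finLap, star_sum, star_mul', star_sub]
    simp [Complex.conj_ofReal]
  rw [hsq, hstar, ← Finset.sum_mul, mul_comm, ← add_mul, finLap, Finset.mul_sum,
    ← Finset.sum_add_distrib]
  congr 1
  exact Finset.sum_congr rfl fun y _ => by ring

/-- A localized deficiency estimate for `Δ² - q` on a finite piece of a weighted graph. -/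
theorem abs_mul_sum_cutoff_le_s19 (hA : ∀ x y, A x y = A y x) (hA0 : ∀ x y, 0 ≤ A x y)
    (hD0 : 0 < D) (hD : ∀ x ∈ T, ∑ y ∈ T, A x y ≤ D) {φ q : V → ℝ} {ε δ ν Q K : ℝ}
    (hδ : 0 < δ) (hδ2 : δ ≤ 1 / 2)
    (hφ0 : ∀ x, 0 ≤ φ x) (hφ1 : ∀ x, φ x ≤ 1) (hφ : ∀ x y, A x y ≠ 0 → |φ x - φ y| ≤ ε)
    (hQ0 : 0 ≤ Q) {u : V → ℂ} (hK : ∑ x ∈ T, ‖u x‖ ^ 2 ≤ K)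
    (hq : ∀ x ∈ T, φ x ≠ 0 → q x ≤ Q)
    (heq : ∀ x ∈ T, φ x ≠ 0 →
      finLap T A (finLap T A u) x = ((ν : ℂ) * Complex.I + (q x : ℂ)) * u x) :
    |ν| * ∑ x ∈ T, φ x ^ 2 * ‖u x‖ ^ 2
      ≤ 2 * K * (δ * Q + D ^ 2 * ε ^ 2 * (1 / δ + 5)) := by
  set v := finLap T A u with hv
  set E := ∑ x ∈ T, ∑ y ∈ T, (A x y : ℂ) * ((φ x : ℂ) ^ 2 - (φ y : ℂ) ^ 2) * star (u y) * v x
    with hE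
  have hEle := norm_commutator_le hA hA0 hD0 hD hδ hφ0 hφ u v
  rw [← hE] at hEle
  have hvle := sum_norm_finLap_sq_le hA hA0 hD0.le hD u
  rw [← hv] at hvle
  have hid := cutoff_energy_identity (T := T) hA φ u
  rw [← hv, ← hE] at hid
  set S := ∑ x ∈ T, φ x ^ 2 * ‖v x‖ ^ 2
  set N := ∑ x ∈ T, φ x ^ 2 * ‖u x‖ ^ 2 with hN
  have hleft : ∑ x ∈ T, (φ x : ℂ) ^ 2 * star (u x) * finLap T A v x
      = ((ν * N : ℝ) : ℂ) * Complex.I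
        + ((∑ x ∈ T, q x * (φ x ^ 2 * ‖u x‖ ^ 2) : ℝ) : ℂ) := by
    rw [hN, Finset.mul_sum, Complex.ofReal_sum, Complex.ofReal_sum, Finset.sum_mul,
      ← Finset.sum_add_distrib]
    refine Finset.sum_congr rfl fun x hx => ?_
    by_cases h0 : φ x = 0
    · simp [h0]
    rw [heq x hx h0]
    push_cast
    rw [← Complex.conj_mul']
    simp only [starRingEnd_apply]
    ring
  rw [hleft] at hid
  set P := ∑ x ∈ T, q x * (φ x ^ 2 * ‖u x‖ ^ 2) with hP
  have him : ν * N = E.im := by simpa using congrArg Complex.im hid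
  have hre : P = S + E.re := by simpa using congrArg Complex.re hid
  have hN0 : 0 ≤ N := Finset.sum_nonneg fun x _ => by positivity
  have hPle : P ≤ Q * K := by
    refine le_trans ?_ (mul_le_mul_of_nonneg_left hK hQ0)
    rw [hP, Finset.mul_sum]
    refine Finset.sum_le_sum fun x hx => ?_
    by_cases h0 : φ x = 0
    · rw [h0, zero_pow two_ne_zero, zero_mul, mul_zero]; positivity
    calc q x * (φ x ^ 2 * ‖u x‖ ^ 2) ≤ Q * (φ x ^ 2 * ‖u x‖ ^ 2) := by
          gcongr; exact hq x hx h0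
      _ ≤ Q * (1 * ‖u x‖ ^ 2) := by
          gcongr
          exact pow_le_one₀ (hφ0 x) (hφ1 x)
      _ = _ := by ring
  have h1 : |ν| * N ≤ ‖E‖ := by
    rw [← abs_of_nonneg hN0, ← abs_mul, him]
    exact Complex.abs_im_le_norm E
  have h2 : S ≤ Q * K + ‖E‖ := by
    have := (abs_le.mp (Complex.abs_re_le_norm E)).1
    linarith
  have h3 : D ^ 2 * ε ^ 2 * (1 / δ + 1) * ∑ x ∈ T, ‖u x‖ ^ 2 + ε ^ 2 * ∑ x ∈ T, ‖v x‖ ^ 2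
      ≤ D ^ 2 * ε ^ 2 * (1 / δ + 5) * K := by
    calc _ ≤ D ^ 2 * ε ^ 2 * (1 / δ + 1) * ∑ x ∈ T, ‖u x‖ ^ 2
          + ε ^ 2 * (4 * D ^ 2 * ∑ x ∈ T, ‖u x‖ ^ 2) := by gcongr
      _ = D ^ 2 * ε ^ 2 * (1 / δ + 5) * ∑ x ∈ T, ‖u x‖ ^ 2 := by ring
      _ ≤ _ := by gcongr
  have h4 : δ * S ≤ δ * (Q * K) + 1 / 2 * ‖E‖ := by
    calc δ * S ≤ δ * (Q * K + ‖E‖) := by gcongr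
      _ = δ * (Q * K) + δ * ‖E‖ := by ring
      _ ≤ _ := by gcongr
  linarith

end FiniteEstimates

section RadialTrees

variable {V : Type*} {G : SimpleGraph V}

theorem SimpleGraph.Connected.finite_setOf_dist_le (hG : G.Connected)
    (hloc : ∀ x, {y | G.Adj x y}.Finite) (x₀ : V) (n : ℕ) : {x | G.dist x₀ x ≤ n}.Finite := by
  induction n with
  | zero =>
    refine (Set.finite_singleton x₀).subset fun x hx => ?_
    simpa [hG.dist_eq_zero_iff, eq_comm] using hx
  | succ n ih =>
    refine (ih.union (ih.biUnion fun x _ => hloc x)).subset fun x hx => ?_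
    rcases Nat.lt_or_ge n (G.dist x₀ x) with h | h
    · obtain ⟨p, hp⟩ := hG.exists_walk_length_eq_dist x₀ x
      have hnil : ¬ p.Nil := by
        intro hnil
        have := SimpleGraph.Walk.length_eq_zero_iff.mpr hnil
        omega
      refine Or.inr (Set.mem_biUnion (x := p.penultimate) ?_ (p.adj_penultimate hnil))
      have h1 := SimpleGraph.dist_le p.dropLast
      have h2 : p.dropLast.length = p.length - 1 := by simp
      simp only [Set.mem_ofPred_eq] at hx ⊢
      omega
    · exact Or.inl h

theorem SimpleGraph.IsTree.subsingleton_parent (hG : G.IsTree) (x₀ x : V) :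
    {y | G.Adj x y ∧ G.dist x₀ x = G.dist x₀ y + 1}.Subsingleton := by
  rintro y ⟨hy, hyd⟩ z ⟨hz, hzd⟩
  have key : ∀ w, G.Adj x w → G.dist x₀ x = G.dist x₀ w + 1 →
      ∃ p : G.Walk x₀ x, p.IsPath ∧ p.penultimate = w := by
    intro w hw hd
    obtain ⟨p, hp⟩ := hG.1.exists_walk_length_eq_dist x₀ w
    refine ⟨p.concat hw.symm, SimpleGraph.Walk.isPath_of_length_eq_dist _ ?_, by simp⟩
    rw [SimpleGraph.Walk.length_concat, hp, hd]
  obtain ⟨p, hp, rfl⟩ := key y hy hyd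
  obtain ⟨p', hp', rfl⟩ := key z hz hzd
  rw [(hG.existsUnique_path x₀ x).unique hp hp']

theorem SimpleGraph.IsTree.ncard_adj_le (hG : G.IsTree) (hloc : ∀ x, {y | G.Adj x y}.Finite)
    (x₀ x : V) : {y | G.Adj x y}.ncard
      ≤ {y | G.Adj x y ∧ G.dist x₀ y = G.dist x₀ x + 1}.ncard + 1 := by
  have hsub := hG.subsingleton_parent x₀ x
  have hcover : {y | G.Adj x y} ⊆ {y | G.Adj x y ∧ G.dist x₀ y = G.dist x₀ x + 1}
      ∪ {y | G.Adj x y ∧ G.dist x₀ x = G.dist x₀ y + 1} := fun y hy =>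
    (hG.dist_eq_dist_add_one_of_adj x₀ hy).elim (fun h => Or.inr ⟨hy, h⟩) fun h => Or.inl ⟨hy, h⟩
  calc _ ≤ _ := Set.ncard_le_ncard hcover
        (((hloc x).subset fun _ h => h.1).union hsub.finite)
    _ ≤ _ := Set.ncard_union_le _ _
    _ ≤ _ := by gcongr; exact (Set.ncard_le_one hsub.finite).mpr fun a ha b hb => hsub ha hb

open scoped Classical in
/-- The real-valued adjacency function of a graph. -/
noncomputable def adjWeight (G : SimpleGraph V) (x y : V) : ℝ := if G.Adj x y then 1 else 0

theorem adjWeight_ne_zero_iff {x y : V} : adjWeight G x y ≠ 0 ↔ G.Adj x y := by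
  simp [adjWeight]

theorem graphLap_eq_finLap {T : Finset V} {x : V} (hT : ∀ y, G.Adj x y → y ∈ T) (u : V → ℂ) :
    graphLap G u x = finLap T (adjWeight G) u x := by
  classical
  rw [graphLap, tsum_eq_sum (s := T), finLap]
  · exact Finset.sum_congr rfl fun y _ => by by_cases h : G.Adj x y <;> simp [adjWeight, h]
  · intro y hy
    rw [if_neg fun h => hy (hT y h), zero_mul]

theorem sum_adjWeight_le (hloc : ∀ x, {y | G.Adj x y}.Finite) (T : Finset V) (x : V) :
    ∑ y ∈ T, adjWeight G x y ≤ {y | G.Adj x y}.ncard := by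
  classical
  simp only [adjWeight, Finset.sum_boole]
  rw [← Set.ncard_coe_finset, Nat.cast_le]
  refine Set.ncard_le_ncard (fun y hy => ?_) (hloc x)
  exact (Finset.mem_filter.mp (Finset.mem_coe.mp hy)).2

/-- The cutoff function decreasing linearly from `1` at the root to `0` at distance `R`. -/
noncomputable def radialCutoff (G : SimpleGraph V) (x₀ : V) (R : ℕ) (x : V) : ℝ :=
  max 0 (1 - (G.dist x₀ x : ℝ) / R)

theorem dist_lt_of_radialCutoff_ne_zero {x₀ x : V} {R : ℕ} (hR : 0 < R)
    (h : radialCutoff G x₀ R x ≠ 0) : G.dist x₀ x < R := by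
  by_contra! hle
  have hR' : (0 : ℝ) < R := by exact_mod_cast hR
  refine h (max_eq_left (sub_nonpos.mpr ((one_le_div hR').mpr (by exact_mod_cast hle))))

theorem abs_radialCutoff_sub_le (hG : G.IsTree) {x₀ x y : V} (R : ℕ) (h : G.Adj x y) :
    |radialCutoff G x₀ R x - radialCutoff G x₀ R y| ≤ 1 / R := by
  refine (abs_max_sub_max_le_max _ _ _ _).trans ?_
  rw [sub_self, abs_zero, max_eq_right (abs_nonneg _)]
  have hd : |(G.dist x₀ y : ℝ) - G.dist x₀ x| ≤ 1 := by
    rcases hG.dist_eq_dist_add_one_of_adj x₀ h with h | h <;> rw [h] <;> simp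
  rw [show 1 - (G.dist x₀ x : ℝ) / R - (1 - (G.dist x₀ y : ℝ) / R)
    = ((G.dist x₀ y : ℝ) - G.dist x₀ x) / R by ring, abs_div, Nat.abs_cast]
  gcongr

theorem rpow_succ_add_two_le {κ : ℝ} (hκ0 : 0 ≤ κ) (hκ1 : κ ≤ 1) {R : ℕ} (hR : 0 < R) :
    ((R + 1 : ℕ) : ℝ) ^ κ + 2 ≤ 4 * (R : ℝ) ^ κ := by
  have hR1 : (1 : ℝ) ≤ R := by exact_mod_cast hR
  have h1 : (1 : ℝ) ≤ (R : ℝ) ^ κ := Real.one_le_rpow hR1 hκ0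
  have h2 : ((R + 1 : ℕ) : ℝ) ^ κ ≤ 2 * (R : ℝ) ^ κ := by
    calc ((R + 1 : ℕ) : ℝ) ^ κ ≤ (2 * R) ^ κ := by
          gcongr; push_cast; linarith
      _ = 2 ^ κ * (R : ℝ) ^ κ := Real.mul_rpow (by norm_num) (by positivity)
      _ ≤ 2 ^ (1 : ℝ) * (R : ℝ) ^ κ := by gcongr; norm_num
      _ = _ := by rw [Real.rpow_one]
  linarith

theorem radialTree_cutoff_estimate {x₀ : V} {κ α : ℝ}
    (hκ0 : 0 ≤ κ) (hκ1 : κ < 1) (hα0 : 0 < α) (hακ : α ≤ 1 - κ)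
    (htree : G.IsTree) (hloc : ∀ x, {y | G.Adj x y}.Finite)
    (hchild : ∀ (n : ℕ) (x : V), G.dist x₀ x = n →
      {y | G.Adj x y ∧ G.dist x₀ y = n + 1}.ncard = Nat.floor ((n : ℝ) ^ κ) + 1)
    {ν : ℝ} {u : V → ℂ} (hu : Summable fun x => ‖u x‖ ^ 2)
    (heq : ∀ x, graphLap G (graphLap G u) x
      = ((ν : ℂ) * Complex.I + (((G.dist x₀ x : ℝ) ^ α : ℝ) : ℂ)) * u x)
    {R : ℕ} (hR : 0 < R) {s : ℝ} (hs : s = (R : ℝ) ^ (-((1 - κ) / 2))) (hs2 : s ^ 3 ≤ 1 / 2)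
    {x : V} (hx : G.dist x₀ x ≤ R) :
    |ν| * (radialCutoff G x₀ R x ^ 2 * ‖u x‖ ^ 2)
      ≤ 2 * (∑' y, ‖u y‖ ^ 2) * (17 * s + 80 * s ^ 4) := by
  have hR1 : (1 : ℝ) ≤ R := by exact_mod_cast hR
  have hR0 : (0 : ℝ) < R := by linarith
  have hs0 : 0 < s := hs ▸ Real.rpow_pos_of_pos hR0 _
  set T := (htree.1.finite_setOf_dist_le hloc x₀ (R + 1)).toFinset with hT
  have hmem : ∀ y, y ∈ T ↔ G.dist x₀ y ≤ R + 1 := fun y => by simp [hT]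
  have hnbr : ∀ y, G.dist x₀ y ≤ R → ∀ z, G.Adj y z → z ∈ T := by
    intro y hy z hz
    rw [hmem]
    rcases htree.dist_eq_dist_add_one_of_adj x₀ hz with h | h <;> omega
  have hsymm : ∀ y z, adjWeight G y z = adjWeight G z y := fun y z => by
    by_cases h : G.Adj y z
    · simp [adjWeight, h, h.symm]
    · simp [adjWeight, h, mt SimpleGraph.Adj.symm h]
  have hnonneg : ∀ y z, 0 ≤ adjWeight G y z := fun y z => by
    unfold adjWeight; split_ifs <;> norm_num
  have hdeg : ∀ y ∈ T, ∑ z ∈ T, adjWeight G y z ≤ 4 * (R : ℝ) ^ κ := by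
    intro y hy
    refine (sum_adjWeight_le hloc T y).trans (le_trans ?_ (rpow_succ_add_two_le hκ0 hκ1.le hR))
    have h1 := htree.ncard_adj_le hloc x₀ y
    rw [hchild _ y rfl] at h1
    have h2 : ((G.dist x₀ y : ℝ)) ^ κ ≤ ((R + 1 : ℕ) : ℝ) ^ κ := by
      gcongr; exact (hmem y).mp hy
    have h3 := Nat.floor_le (a := (G.dist x₀ y : ℝ) ^ κ) (by positivity)
    have h4 : ({z | G.Adj y z}.ncard : ℝ) ≤ (⌊(G.dist x₀ y : ℝ) ^ κ⌋₊ : ℝ) + 1 + 1 := by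
      exact_mod_cast h1
    linarith
  have hloceq : ∀ y ∈ T, radialCutoff G x₀ R y ≠ 0 →
      finLap T (adjWeight G) (finLap T (adjWeight G) u) y
        = ((ν : ℂ) * Complex.I + (((G.dist x₀ y : ℝ) ^ α : ℝ) : ℂ)) * u y := by
    intro y _ hy
    have hyR := dist_lt_of_radialCutoff_ne_zero hR hy
    rw [← heq y, graphLap_eq_finLap (hnbr y hyR.le), finLap, finLap.eq_1 T _ (graphLap G u)]
    refine Finset.sum_congr rfl fun z _ => ?_
    by_cases hz : G.Adj y z
    · have hzR : G.dist x₀ z ≤ R := by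
        rcases htree.dist_eq_dist_add_one_of_adj x₀ hz with h | h <;> omega
      rw [graphLap_eq_finLap (hnbr y hyR.le), graphLap_eq_finLap (hnbr z hzR)]
    · simp [adjWeight, hz]
  have hpot : ∀ y ∈ T, radialCutoff G x₀ R y ≠ 0 →
      (G.dist x₀ y : ℝ) ^ α ≤ (R : ℝ) ^ (1 - κ) := by
    intro y _ hy
    have hyR := (dist_lt_of_radialCutoff_ne_zero hR hy).le
    calc (G.dist x₀ y : ℝ) ^ α ≤ (R : ℝ) ^ α := by gcongr
      _ ≤ _ := Real.rpow_le_rpow_of_exponent_le hR1 hακ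
  have main := abs_mul_sum_cutoff_le_s19 (ε := 1 / (R : ℝ)) (δ := s ^ 3) hsymm hnonneg
    (by positivity) hdeg (by positivity) hs2 (fun y => le_max_left _ _)
    (fun y => max_le zero_le_one (sub_le_self _ (by positivity)))
    (fun y z h => abs_radialCutoff_sub_le htree R (adjWeight_ne_zero_iff.mp h))
    (by positivity) (hu.sum_le_tsum T fun _ _ => by positivity) hpot hloceq
  have hsingle : radialCutoff G x₀ R x ^ 2 * ‖u x‖ ^ 2
      ≤ ∑ y ∈ T, radialCutoff G x₀ R y ^ 2 * ‖u y‖ ^ 2 :=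
    Finset.single_le_sum (f := fun y => radialCutoff G x₀ R y ^ 2 * ‖u y‖ ^ 2)
      (fun _ _ => by positivity) ((hmem x).mpr (by omega))
  have hsR : s ^ 2 * (R : ℝ) ^ (1 - κ) = 1 := by
    rw [hs, ← Real.rpow_natCast, ← Real.rpow_mul hR0.le, ← Real.rpow_add hR0]
    convert Real.rpow_zero (R : ℝ) using 2
    push_cast; ring
  have hsκ : s ^ 2 * R = (R : ℝ) ^ κ := by
    have : (R : ℝ) = (R : ℝ) ^ (1 - κ) * (R : ℝ) ^ κ := by
      rw [← Real.rpow_add hR0]; simp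
    calc s ^ 2 * R = s ^ 2 * ((R : ℝ) ^ (1 - κ) * (R : ℝ) ^ κ) := by rw [← this]
      _ = (s ^ 2 * (R : ℝ) ^ (1 - κ)) * (R : ℝ) ^ κ := by ring
      _ = _ := by rw [hsR, one_mul]
  calc _ ≤ |ν| * ∑ y ∈ T, radialCutoff G x₀ R y ^ 2 * ‖u y‖ ^ 2 := by gcongr
    _ ≤ _ := main
    _ = 2 * (∑' y, ‖u y‖ ^ 2) * (s * (s ^ 2 * (R : ℝ) ^ (1 - κ))
          + (4 * (s ^ 2 * R)) ^ 2 * (1 / (R : ℝ)) ^ 2 * (1 / s ^ 3 + 5)) := by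
        rw [hsκ]; ring
    _ = _ := by
        rw [hsR]; field_simp; ring

end RadialTrees

/-- For a radial tree rooted at `x₀` in which every vertex at distance `n` from the root
has `⌊n^κ⌋ + 1` children (`0 ≤ κ < 1`), with unit edge and vertex weights, and potential
`W(x) = −n^α` for `x` at distance `n`, where `0 < α ≤ 1 − κ`, the operator `Δ²u + Wu` is
essentially self-adjoint on finitely supported functions in `ℓ²(V)`.

Essential self-adjointness is formalized via the deficiency-index criterion: for every
`ν ≠ 0`, the only `u ∈ ℓ²` with `Δ²u + Wu ∈ ℓ²` and `Δ²u + Wu = iνu` is `u = 0`. -/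
theorem radialTree_biLaplacian_essentially_selfAdjoint {V : Type*} [Countable V]
    (G : SimpleGraph V) (x₀ : V) (κ α : ℝ)
    (hκ0 : 0 ≤ κ) (hκ1 : κ < 1) (hα0 : 0 < α) (hακ : α ≤ 1 - κ)
    (htree : G.IsTree) (hloc : ∀ x, {y | G.Adj x y}.Finite)
    (hchild : ∀ (n : ℕ) (x : V), G.dist x₀ x = n →
      {y | G.Adj x y ∧ G.dist x₀ y = n + 1}.ncard = Nat.floor ((n : ℝ) ^ κ) + 1)
    (W : V → ℝ) (hW : ∀ x, W x = -((G.dist x₀ x : ℝ) ^ α)) :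
    ∀ ν : ℝ, ν ≠ 0 → ∀ u : V → ℂ,
      (Summable fun x => ‖u x‖ ^ 2) →
      (Summable fun x => ‖graphLap G (graphLap G u) x + (W x : ℂ) * u x‖ ^ 2) →
      (∀ x, graphLap G (graphLap G u) x + (W x : ℂ) * u x = (ν : ℂ) * Complex.I * u x) →
      u = 0 := by
  intro ν hν u hu _ heq
  have heq' : ∀ x, graphLap G (graphLap G u) x
      = ((ν : ℂ) * Complex.I + (((G.dist x₀ x : ℝ) ^ α : ℝ) : ℂ)) * u x := by
    intro x
    have h := heq x
    rw [hW x, Complex.ofReal_neg] at h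
    linear_combination h
  have hs : Filter.Tendsto (fun R : ℕ => (R : ℝ) ^ (-((1 - κ) / 2))) Filter.atTop (nhds 0) :=
    (tendsto_rpow_neg_atTop (by linarith)).comp tendsto_natCast_atTop_atTop
  funext x
  have hcut : Filter.Tendsto (fun R : ℕ => radialCutoff G x₀ R x) Filter.atTop (nhds 1) := by
    have h : Filter.Tendsto (fun R : ℕ => max 0 (1 - (G.dist x₀ x : ℝ) / R)) Filter.atTop
        (nhds (max 0 (1 - 0))) :=
      tendsto_const_nhds.max
        (tendsto_const_nhds.sub (tendsto_const_div_atTop_nhds_zero_nat _))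
    simpa [radialCutoff] using h
  have hleft := ((hcut.pow 2).mul_const (‖u x‖ ^ 2)).const_mul |ν|
  have hright := ((hs.const_mul 17).add ((hs.pow 4).const_mul 80)).const_mul
    (2 * ∑' y, ‖u y‖ ^ 2)
  have hsmall : ∀ᶠ R : ℕ in Filter.atTop, ((R : ℝ) ^ (-((1 - κ) / 2))) ^ 3 ≤ 1 / 2 := by
    have h := hs.pow 3
    exact h.eventually_le_const (by norm_num)
  have hle := le_of_tendsto_of_tendsto hleft hright (by
    filter_upwards [hsmall, Filter.eventually_gt_atTop 0,
      Filter.eventually_ge_atTop (G.dist x₀ x)] with R h1 h2 h3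
    exact radialTree_cutoff_estimate hκ0 hκ1 hα0 hακ htree hloc hchild hu heq' h2 rfl h1 h3)
  have hν' : 0 < |ν| := abs_pos.mpr hν
  have hzero : ‖u x‖ ^ 2 ≤ 0 := by
    norm_num at hle
    nlinarith [sq_nonneg ‖u x‖]
  simpa using le_antisymm hzero (sq_nonneg _)
end
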